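/- arXiv:2504.10722 — 3 statements merged into one kernel-verified Lean document; each statement's English description precedes it below -/
import Mathlib

section
/- An integral domain D is a GL-domain if and only if every nonzero nonunit element of D is prime-like. -/
/-- A polynomial over `D` is primitive if every element of `D` dividing all of its
coefficients is a unit. -/
def IsPrimitivePoly {D : Type*} [CommRing D] (f : Polynomial D) : Prop :=
  ∀ d : D, (∀ n : ℕ, d ∣ f.coeff n) → IsUnit d

/-- `D` is a GL-domain if the product of any two primitive polynomials over `D` is
again primitive. -/
def IsGLDomain (D : Type*) [CommRing D] : Prop :=
  ∀ f g : Polynomial D, IsPrimitivePoly f → IsPrimitivePoly g → IsPrimitivePoly (f * g)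

/-- A nonzero nonunit `p` is prime-like if whenever `p ∣ r * s` there is a nonunit
divisor `d` of `p` such that `d ∣ r` or `d ∣ s`. -/
def IsPrimeLike {D : Type*} [CommRing D] (p : D) : Prop :=
  ∀ r s : D, p ∣ r * s → ∃ d : D, ¬ IsUnit d ∧ d ∣ p ∧ (d ∣ r ∨ d ∣ s)

/-- If every nonzero nonunit is prime-like, then a nonunit dividing a product of polynomials
has a nonunit divisor dividing one of the factors. -/
theorem exists_nonunit_C_dvd_or_C_dvd {D : Type*} [CommRing D]
    (h : ∀ p : D, p ≠ 0 → ¬ IsUnit p → IsPrimeLike p) {d : D} (hd0 : d ≠ 0)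
    (hd : ¬ IsUnit d) (f g : Polynomial D) (hfg : Polynomial.C d ∣ f * g) :
    ∃ c : D, ¬ IsUnit c ∧ c ∣ d ∧ (Polynomial.C c ∣ f ∨ Polynomial.C c ∣ g) := by
  induction hn : f.support.card + g.support.card using Nat.strong_induction_on
    generalizing d f g with
  | _ n ih =>
    subst hn
    by_cases hf : f = 0
    · exact ⟨d, hd, dvd_rfl, .inl (hf ▸ dvd_zero _)⟩
    by_cases hg : g = 0
    · exact ⟨d, hd, dvd_rfl, .inr (hg ▸ dvd_zero _)⟩
    have hlead : d ∣ f.leadingCoeff * g.leadingCoeff := by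
      rw [← Polynomial.coeff_mul_degree_add_degree]
      exact (Polynomial.C_dvd_iff_dvd_coeff _ _).1 hfg _
    have C_dvd_monomial {a b : D} (k : ℕ) (hab : a ∣ b) :
        Polynomial.C a ∣ Polynomial.monomial k b := by
      rw [← Polynomial.C_mul_X_pow_eq_monomial]
      exact (map_dvd Polynomial.C hab).mul_right _
    obtain ⟨e, he, hed, hl⟩ := h d hd0 hd _ _ hlead
    have he0 : e ≠ 0 := ne_zero_of_dvd_ne_zero hd0 hed
    have hefg : Polynomial.C e ∣ f * g := (map_dvd Polynomial.C hed).trans hfg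
    rcases hl with hl | hl
    · have hm := C_dvd_monomial f.natDegree hl
      have hcard := Polynomial.eraseLead_support_card_lt hf
      obtain ⟨c, hc, hce, hcf | hcg⟩ := ih _ (by lia) he0 he f.eraseLead g (by
        rw [← Polynomial.self_sub_monomial_natDegree_leadingCoeff, sub_mul]
        exact dvd_sub hefg (hm.mul_right _)) rfl
      · refine ⟨c, hc, hce.trans hed, .inl ?_⟩
        rw [← f.eraseLead_add_monomial_natDegree_leadingCoeff]
        exact dvd_add hcf ((map_dvd Polynomial.C hce).trans hm)
      · exact ⟨c, hc, hce.trans hed, .inr hcg⟩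
    · have hm := C_dvd_monomial g.natDegree hl
      have hcard := Polynomial.eraseLead_support_card_lt hg
      obtain ⟨c, hc, hce, hcf | hcg⟩ := ih _ (by lia) he0 he f g.eraseLead (by
        rw [← g.self_sub_monomial_natDegree_leadingCoeff, mul_sub]
        exact dvd_sub hefg (hm.mul_left _)) rfl
      · exact ⟨c, hc, hce.trans hed, .inl hcf⟩
      · refine ⟨c, hc, hce.trans hed, .inr ?_⟩
        rw [← g.eraseLead_add_monomial_natDegree_leadingCoeff]
        exact dvd_add hcg ((map_dvd Polynomial.C hce).trans hm)

theorem IsPrimitivePoly.ne_zero {D : Type*} [CommRing D] [Nontrivial D] {f : Polynomial D}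
    (hf : IsPrimitivePoly f) : f ≠ 0 := by
  rintro rfl
  exact not_isUnit_zero (hf 0 (by simp))

theorem isPrimitivePoly_C_add_C_mul_X {D : Type*} [CommRing D] {p r : D}
    (h : ∀ d, d ∣ p → d ∣ r → IsUnit d) :
    IsPrimitivePoly (Polynomial.C p + Polynomial.C r * Polynomial.X) := fun d hd =>
  h d (by simpa using hd 0) (by simpa [Polynomial.coeff_C] using hd 1)

theorem stmt1 {D : Type*} [CommRing D] [IsDomain D] :
    IsGLDomain D ↔ ∀ p : D, p ≠ 0 → ¬ IsUnit p → IsPrimeLike p := by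
  constructor
  · intro h p _ hp r s hrs
    by_contra! hcon
    refine hp (h _ _
      (isPrimitivePoly_C_add_C_mul_X fun d hdp hdr => ?_)
      (isPrimitivePoly_C_add_C_mul_X fun d hdp hds => ?_) p
      ((Polynomial.C_dvd_iff_dvd_coeff p ((Polynomial.C p + Polynomial.C r * Polynomial.X) *
        (Polynomial.C p + Polynomial.C s * Polynomial.X))).1 ?_))
    · by_contra hd
      exact (hcon d hd hdp).1 hdr
    · by_contra hd
      exact (hcon d hd hdp).2 hds
    · obtain ⟨t, ht⟩ := hrs
      have hC : (Polynomial.C r * Polynomial.C s : Polynomial D) =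
          Polynomial.C p * Polynomial.C t := by rw [← map_mul, ht, map_mul]
      refine ⟨Polynomial.C p + (Polynomial.C r + Polynomial.C s) * Polynomial.X +
        Polynomial.C t * Polynomial.X ^ 2, ?_⟩
      linear_combination Polynomial.X ^ 2 * hC
  · intro h f g hf hg d hd
    by_contra hdu
    have hd0 : d ≠ 0 := by
      rintro rfl
      exact mul_ne_zero hf.ne_zero hg.ne_zero
        (Polynomial.ext fun n => by simpa using hd n)
    obtain ⟨c, hc, -, hcf | hcg⟩ := exists_nonunit_C_dvd_or_C_dvd h hd0 hdu f g
      ((Polynomial.C_dvd_iff_dvd_coeff _ _).2 hd)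
    · exact hc (hf c ((Polynomial.C_dvd_iff_dvd_coeff _ _).1 hcf))
    · exact hc (hg c ((Polynomial.C_dvd_iff_dvd_coeff _ _).1 hcg))
end

section
/- If D is an MCD-domain that is a GL-domain, then D is a pre-Schreier domain. -/
/-- `d` is a maximal common divisor of the finite set `S`: it is a common divisor of `S`
and every common divisor of `S` divisible by `d` is an associate of `d`. -/
def IsMCDOf {D : Type*} [CommRing D] (d : D) (S : Finset D) : Prop :=
  (∀ s ∈ S, d ∣ s) ∧ ∀ d' : D, (∀ s ∈ S, d' ∣ s) → d ∣ d' → Associated d d'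

/-- `D` is an MCD-domain if every nonempty finite set of nonzero elements of `D`
has a maximal common divisor. -/
def IsMCDDomain (D : Type*) [CommRing D] : Prop :=
  ∀ S : Finset D, S.Nonempty → (∀ s ∈ S, s ≠ 0) → ∃ d : D, IsMCDOf d S

/-- A nonzero element `p` is primal if whenever `p ∣ r * s` we can write `p = p₁ * p₂`
with `p₁ ∣ r` and `p₂ ∣ s`. -/
def IsPrimalElem {D : Type*} [CommRing D] (p : D) : Prop :=
  ∀ r s : D, p ∣ r * s → ∃ p₁ p₂ : D, p = p₁ * p₂ ∧ p₁ ∣ r ∧ p₂ ∣ s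

/-- `D` is pre-Schreier if every nonzero nonunit of `D` is primal. -/
def IsPreSchreier (D : Type*) [CommRing D] : Prop :=
  ∀ p : D, p ≠ 0 → ¬ IsUnit p → IsPrimalElem p

/-- In an MCD-domain, two nonzero elements become relatively prime after dividing out
a maximal common divisor. -/
theorem IsMCDDomain.exists_eq_mul_isRelPrime {D : Type*} [CommRing D] [IsDomain D]
    (hMCD : IsMCDDomain D) {x y : D} (hx : x ≠ 0) (hy : y ≠ 0) :
    ∃ d x' y' : D, x = d * x' ∧ y = d * y' ∧ IsRelPrime x' y' := by
  classical
  obtain ⟨d, hd, hmax⟩ := hMCD {x, y} (by simp) (by simp [hx, hy])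
  obtain ⟨x', rfl⟩ := hd x (by simp)
  obtain ⟨y', rfl⟩ := hd y (by simp)
  refine ⟨d, x', y', rfl, rfl, fun e hex hey => ?_⟩
  obtain ⟨u, hu⟩ := hmax (d * e) (by simp [mul_dvd_mul_left, hex, hey]) (dvd_mul_right d e)
  exact mul_left_cancel₀ (left_ne_zero_of_mul hx) hu ▸ u.isUnit

open Polynomial in
theorem isPrimitivePoly_C_add_C_mul_X_s2 {D : Type*} [CommRing D] {a b : D}
    (h : IsRelPrime a b) : IsPrimitivePoly (C a + C b * X) := fun d hd =>
  h (by simpa using hd 0) (by simpa [coeff_C] using hd 1)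

open Polynomial in
/-- In a GL-domain, an element relatively prime to both `r` and `s` divides `r * s` only
if it is a unit. -/
theorem IsGLDomain.isUnit_of_dvd_mul {D : Type*} [CommRing D] (hGL : IsGLDomain D)
    {p r s : D} (hr : IsRelPrime p r) (hs : IsRelPrime p s) (h : p ∣ r * s) : IsUnit p := by
  refine hGL _ _ (isPrimitivePoly_C_add_C_mul_X_s2 hr) (isPrimitivePoly_C_add_C_mul_X_s2 hs) p ?_
  rw [← C_dvd_iff_dvd_coeff]
  obtain ⟨t, ht⟩ := h
  refine ⟨C p + C (r + s) * X + C t * X ^ 2, ?_⟩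
  have hC : (C r * C s : D[X]) = C p * C t := by rw [← C_mul, ht, C_mul]
  rw [C_add]
  linear_combination X ^ 2 * hC

theorem stmt2 {D : Type*} [CommRing D] [IsDomain D]
    (hMCD : IsMCDDomain D) (hGL : IsGLDomain D) : IsPreSchreier D := by
  intro p hp _ r s h
  rcases eq_or_ne r 0 with rfl | hr
  · exact ⟨p, 1, by simp, dvd_zero p, one_dvd s⟩
  rcases eq_or_ne s 0 with rfl | hs
  · exact ⟨1, p, by simp, one_dvd r, dvd_zero p⟩
  obtain ⟨a, p', r', rfl, rfl, hpr⟩ := hMCD.exists_eq_mul_isRelPrime hp hr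
  obtain ⟨b, q, s', rfl, rfl, hqs⟩ :=
    hMCD.exists_eq_mul_isRelPrime (right_ne_zero_of_mul hp) hs
  have hq : q ∣ r' * s' := by
    refine (mul_dvd_mul_iff_left (left_ne_zero_of_mul (right_ne_zero_of_mul hp))).1
      ((mul_dvd_mul_iff_left (left_ne_zero_of_mul hp)).1 ?_)
    convert h using 1
    ring
  have hu : IsUnit q :=
    hGL.isUnit_of_dvd_mul (hpr.of_dvd_left (dvd_mul_left q b)) hqs hq
  exact ⟨a, b * q, rfl, dvd_mul_right a r', mul_dvd_mul_left b hu.dvd⟩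
end

section
/- Let R₀ = 𝔽₂[M] where M = ℚ≥0 × ℚ≥0 × ℚ≥0 × (ℕ → ℚ≥0), and let R be the 𝔽₂-subalgebra of R₀ generated by the monomials X^α, Y^α, Z^α for α ∈ ℚ≥0 together with all monomials X^α ∏_i T_i^{t(i)}, Y^α ∏_i T_i^{t(i)}, Z^α ∏_i T_i^{t(i)} with α ∈ ℚ, α > 0, and t : ℕ → ℚ≥0. Then R is not MCD-finite; more precisely, there exist two nonzero elements of R admitting infinitely many pairwise non-associate maximal common divisors in R. -/
/-- The additive monoid `ℚ≥0 × ℚ≥0 × ℚ≥0 × (ℕ → ℚ≥0)` of exponents of the monomials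
`X^a Y^b Z^c ∏_i T_i^(t i)`. -/
abbrev ExpMonoid : Type := ℚ≥0 × ℚ≥0 × ℚ≥0 × (ℕ → ℚ≥0)

/-- The monoid algebra `R₀ = 𝔽₂[ExpMonoid]`. -/
abbrev RZero : Type := AddMonoidAlgebra (ZMod 2) ExpMonoid

/-- The generating monomials of `R`: the monomials `X^α`, `Y^α`, `Z^α` for `α ∈ ℚ≥0`,
together with the monomials `X^α ∏_i T_i^(t i)`, `Y^α ∏_i T_i^(t i)`, `Z^α ∏_i T_i^(t i)`
for a positive rational `α` and `t : ℕ → ℚ≥0`. -/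
def GenSet : Set RZero :=
  { x | (∃ α : ℚ≥0, x = AddMonoidAlgebra.single (α, 0, 0, 0) 1)
      ∨ (∃ α : ℚ≥0, x = AddMonoidAlgebra.single (0, α, 0, 0) 1)
      ∨ (∃ α : ℚ≥0, x = AddMonoidAlgebra.single (0, 0, α, 0) 1)
      ∨ (∃ (α : ℚ≥0) (t : ℕ → ℚ≥0), 0 < α ∧ x = AddMonoidAlgebra.single (α, 0, 0, t) 1)
      ∨ (∃ (α : ℚ≥0) (t : ℕ → ℚ≥0), 0 < α ∧ x = AddMonoidAlgebra.single (0, α, 0, t) 1)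
      ∨ (∃ (α : ℚ≥0) (t : ℕ → ℚ≥0), 0 < α ∧ x = AddMonoidAlgebra.single (0, 0, α, t) 1) }

/-- The subalgebra `R` of `R₀` generated by `GenSet`. -/
noncomputable def RSub : Subalgebra (ZMod 2) RZero := Algebra.adjoin (ZMod 2) GenSet

namespace AddMonoidAlgebra

/-- If `A` has the two unique sums property, then the factors of a nonzero monomial over a
semiring without zero divisors are monomials. -/
theorem exists_single_of_mul_eq_single {k A : Type*} [Semiring k] [NoZeroDivisors k] [Add A]
    [TwoUniqueSums A] {f g : AddMonoidAlgebra k A} {m : A} {r : k} (hr : r ≠ 0)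
    (h : f * g = single m r) :
    ∃ (p q : A) (a b : k), f = single p a ∧ g = single q b ∧ a ≠ 0 ∧ p + q = m := by
  have hfg : f * g ≠ 0 := by simpa [h] using hr
  have eq_of_unique {p q : A} (hp : p ∈ f.coeff.support) (hq : q ∈ g.coeff.support)
      (hu : UniqueAdd f.coeff.support g.coeff.support p q) : p + q = m := by
    have hc := coeff_mul_add_of_uniqueAdd hu
    by_contra hne
    rw [h, coeff_single, Finsupp.single_eq_of_ne hne] at hc
    exact mul_ne_zero (Finsupp.mem_support_iff.mp hp) (Finsupp.mem_support_iff.mp hq) hc.symm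
  have hf : f.coeff.support.Nonempty := by
    simpa [Finsupp.support_nonempty_iff] using left_ne_zero_of_mul hfg
  have hg : g.coeff.support.Nonempty := by
    simpa [Finsupp.support_nonempty_iff] using right_ne_zero_of_mul hfg
  have hcard : f.coeff.support.card * g.coeff.support.card ≤ 1 := by
    by_contra! hlt
    obtain ⟨x, hx, y, hy, hxy, hux, huy⟩ := TwoUniqueSums.uniqueAdd_of_one_lt_card hlt
    rw [Finset.mem_product] at hx hy
    have := hux hy.1 hy.2 ((eq_of_unique hy.1 hy.2 huy).trans (eq_of_unique hx.1 hx.2 hux).symm)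
    exact hxy (Prod.ext this.1.symm this.2.symm)
  have hf1 : f.coeff.support.card = 1 := by
    have := hf.card_pos; have := hg.card_pos; nlinarith
  have hg1 : g.coeff.support.card = 1 := by
    have := hf.card_pos; have := hg.card_pos; nlinarith
  obtain ⟨p, a, ha, hfa⟩ := Finsupp.card_support_eq_one'.mp hf1
  obtain ⟨q, b, hb, hgb⟩ := Finsupp.card_support_eq_one'.mp hg1
  obtain rfl : f = single p a := coeff_injective (by simpa using hfa)
  obtain rfl : g = single q b := coeff_injective (by simpa using hgb)
  rw [single_mul_single] at h
  refine ⟨p, q, a, b, rfl, rfl, ha, ?_⟩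
  have := congrArg (fun x ↦ x.coeff (p + q)) h
  by_contra hne
  simp [coeff_single, Finsupp.single_eq_of_ne hne, ha, hb] at this

end AddMonoidAlgebra

open AddMonoidAlgebra

instance : TwoUniqueSums ExpMonoid :=
  have : TwoUniqueSums (ℚ≥0 × (ℕ → ℚ≥0)) := inferInstance
  have : TwoUniqueSums (ℚ≥0 × ℚ≥0 × (ℕ → ℚ≥0)) := inferInstance
  Prod.instTwoUniqueSums

instance : IsCancelMulZero RZero := inferInstance

instance : IsDomain RSub := inferInstance

/-- The only pure `T`-monomial occurring in an element of `RSub` is `1`. -/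
theorem eq_zero_of_mem_support_of_mem_RSub {f : RZero} (hf : f ∈ RSub) {t : ℕ → ℚ≥0}
    (ht : ((0, 0, 0, t) : ExpMonoid) ∈ f.coeff.support) : t = 0 := by
  classical
  induction hf using Algebra.adjoin_induction generalizing t with
  | mem x hx =>
    have key {p : ExpMonoid} (hx : x = single p 1) : p = (0, 0, 0, t) := by
      subst hx
      exact (Finset.mem_singleton.mp (Finsupp.support_single_subset ht)).symm
    obtain ⟨α, hx⟩ | ⟨α, hx⟩ | ⟨α, hx⟩ | ⟨α, s, hα, hx⟩ | ⟨α, s, hα, hx⟩ | ⟨α, s, hα, hx⟩ := hx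
    all_goals
      have := key hx
      simp only [Prod.mk.injEq] at this
      first
      | exact this.2.2.2.symm
      | exact absurd this.1 hα.ne'
      | exact absurd this.2.1 hα.ne'
      | exact absurd this.2.2.1 hα.ne'
  | algebraMap r =>
    by_contra hne
    have hne' : (0 : ExpMonoid) ≠ (0, 0, 0, t) := fun h ↦ hne (congrArg (·.2.2.2) h).symm
    simp [coe_algebraMap, hne'] at ht
  | add x y _ _ hx hy =>
    obtain h | h := Finset.mem_union.mp (Finsupp.support_add (by simpa using ht))
    exacts [hx h, hy h]
  | mul x y _ _ hx hy =>
    obtain ⟨p, hp, q, hq, hpq⟩ := Finset.mem_add.mp (support_coeff_mul_subset x y ht)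
    obtain ⟨p1, p2, p3, p4⟩ := p
    obtain ⟨q1, q2, q3, q4⟩ := q
    simp only [Prod.mk_add_mk, Prod.mk.injEq, add_eq_zero] at hpq
    obtain ⟨⟨rfl, rfl⟩, ⟨rfl, rfl⟩, ⟨rfl, rfl⟩, rfl⟩ := hpq
    rw [hx hp, hy hq, add_zero]

/-- In `RSub`, a common divisor of `X T^s` and `Y T^s` is trivial. -/
theorem eq_one_of_mul_eq_single {f u v : RZero} (hf : f ∈ RSub) {s : ℕ → ℚ≥0}
    (hu : f * u = single (1, 0, 0, s) 1) (hv : f * v = single (0, 1, 0, s) 1) : f = 1 := by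
  obtain ⟨p, q, a, b, rfl, -, ha, hpq⟩ := exists_single_of_mul_eq_single one_ne_zero hu
  obtain ⟨p', q', a', b', hpp, -, -, hpq'⟩ := exists_single_of_mul_eq_single one_ne_zero hv
  obtain rfl : p = p' := by
    by_contra hne
    have := congrArg (fun x ↦ x.coeff p) hpp
    simp [coeff_single, Finsupp.single_eq_of_ne hne, ha] at this
  obtain ⟨p1, p2, p3, p4⟩ := p
  obtain ⟨q1, q2, q3, q4⟩ := q
  obtain ⟨r1, r2, r3, r4⟩ := q'
  simp only [Prod.mk_add_mk, Prod.mk.injEq, add_eq_zero] at hpq hpq'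
  obtain ⟨-, ⟨rfl, -⟩, ⟨rfl, -⟩, -⟩ := hpq
  obtain ⟨⟨rfl, -⟩, -⟩ := hpq'
  obtain rfl : p4 = 0 := eq_zero_of_mem_support_of_mem_RSub hf (by simpa [coeff_single] using ha)
  obtain rfl : a = 1 := (by decide : ∀ a : ZMod 2, a ≠ 0 → a = 1) a ha
  rfl

theorem single_X_mem_RSub (t : ℕ → ℚ≥0) : single (1, 0, 0, t) 1 ∈ RSub :=
  Algebra.subset_adjoin <| .inr <| .inr <| .inr <| .inl ⟨1, t, one_pos, rfl⟩

theorem single_Y_mem_RSub (t : ℕ → ℚ≥0) : single (0, 1, 0, t) 1 ∈ RSub :=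
  Algebra.subset_adjoin <| .inr <| .inr <| .inr <| .inr <| .inl ⟨1, t, one_pos, rfl⟩

theorem single_Z_mem_RSub (t : ℕ → ℚ≥0) : single (0, 0, 1, t) 1 ∈ RSub :=
  Algebra.subset_adjoin <| .inr <| .inr <| .inr <| .inr <| .inr ⟨1, t, one_pos, rfl⟩

/-- In `RSub`, the monomial `Z T^t` is a maximal common divisor of `X Z T^w` and `Y Z T^w`
whenever `t + s = w`. -/
theorem eq_of_single_Z_dvd {t s w : ℕ → ℚ≥0} (hw : t + s = w) {e : RSub}
    (hX : e ∣ ⟨_, single_X_mem_RSub 0⟩ * ⟨_, single_Z_mem_RSub w⟩)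
    (hY : e ∣ ⟨_, single_Y_mem_RSub 0⟩ * ⟨_, single_Z_mem_RSub w⟩)
    (he : ⟨_, single_Z_mem_RSub t⟩ ∣ e) : ⟨_, single_Z_mem_RSub t⟩ = e := by
  obtain ⟨k, rfl⟩ := he
  obtain ⟨u, hu⟩ := hX
  obtain ⟨v, hv⟩ := hY
  have hd : (single (0, 0, 1, t) 1 : RZero) ≠ 0 := by simp
  have hk : (k : RZero) = 1 := by
    refine eq_one_of_mul_eq_single (u := u) (v := v) (s := s) k.2
      (mul_left_cancel₀ hd ?_) (mul_left_cancel₀ hd ?_)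
    · have := congrArg Subtype.val hu
      simp only [MulMemClass.coe_mul, mul_assoc] at this
      rw [← this]
      simp [single_mul_single, hw]
    · have := congrArg Subtype.val hv
      simp only [MulMemClass.coe_mul, mul_assoc] at this
      rw [← this]
      simp [single_mul_single, hw]
  rw [show k = 1 from Subtype.ext hk, mul_one]

/-- In `RSub`, distinct monomials `Z T^t` are not associated. -/
theorem eq_of_associated_single_Z {t w : ℕ → ℚ≥0}
    (h : Associated (⟨_, single_Z_mem_RSub t⟩ : RSub) ⟨_, single_Z_mem_RSub w⟩) : t = w := by
  obtain ⟨k, hk⟩ := h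
  obtain ⟨p, q, a, b, hp, -, ha, hpq⟩ := exists_single_of_mul_eq_single
    (f := (k : RSub).1) (g := ((k⁻¹ : RSubˣ) : RSub).1) (m := 0) (one_ne_zero (α := ZMod 2))
    (congrArg Subtype.val k.mul_inv)
  obtain rfl : p = 0 := (add_eq_zero.mp hpq).1
  have := congrArg Subtype.val hk
  simp only [MulMemClass.coe_mul, hp, single_mul_single] at this
  by_contra hne
  have hc := congrArg (fun x ↦ x.coeff ((0, 0, 1, t) : ExpMonoid)) this
  simp [coeff_single, ha, Ne.symm hne] at hc

/-- `R` is not MCD-finite: there exist two nonzero elements of `R` admitting an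
infinite family of pairwise non-associate maximal common divisors in `R`. -/
theorem stmt14 :
    ∃ a b : ↥RSub, a ≠ 0 ∧ b ≠ 0 ∧
      ∃ d : ℕ → ↥RSub,
        (∀ i : ℕ, d i ∣ a ∧ d i ∣ b ∧
          ∀ e : ↥RSub, e ∣ a → e ∣ b → d i ∣ e → Associated (d i) e) ∧
        (∀ i j : ℕ, i ≠ j → ¬ Associated (d i) (d j)) := by
  have hne (t : ℕ → ℚ≥0) : (⟨_, single_Z_mem_RSub t⟩ : RSub) ≠ 0 := by
    simp [← Subtype.coe_ne_coe]
  have hadd (i : ℕ) : (fun _ : ℕ ↦ ((i : ℚ≥0) + 1)⁻¹) + (1 - fun _ ↦ ((i : ℚ≥0) + 1)⁻¹) = 1 :=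
    add_tsub_cancel_of_le fun _ ↦ inv_le_one_of_one_le₀ (by simp)
  refine ⟨⟨_, single_X_mem_RSub 0⟩ * ⟨_, single_Z_mem_RSub 1⟩,
    ⟨_, single_Y_mem_RSub 0⟩ * ⟨_, single_Z_mem_RSub 1⟩,
    mul_ne_zero (by simp [← Subtype.coe_ne_coe]) (hne 1),
    mul_ne_zero (by simp [← Subtype.coe_ne_coe]) (hne 1),
    fun i ↦ ⟨_, single_Z_mem_RSub fun _ ↦ ((i : ℚ≥0) + 1)⁻¹⟩,
    fun i ↦ ⟨⟨⟨_, single_X_mem_RSub (1 - fun _ ↦ ((i : ℚ≥0) + 1)⁻¹)⟩, Subtype.ext ?_⟩,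
      ⟨⟨_, single_Y_mem_RSub (1 - fun _ ↦ ((i : ℚ≥0) + 1)⁻¹)⟩, Subtype.ext ?_⟩,
      fun e hX hY he ↦ .of_eq (eq_of_single_Z_dvd (hadd i) hX hY he)⟩,
    fun i j hij h ↦ hij ?_⟩
  · simp only [MulMemClass.coe_mul, single_mul_single, Prod.mk_add_mk, hadd]
    simp
  · simp only [MulMemClass.coe_mul, single_mul_single, Prod.mk_add_mk, hadd]
    simp
  · simpa using congrFun (eq_of_associated_single_Z h) 0
end
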